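/- Assume the functoriality has good coproducts, satisfies 𝒞-independence, has a symmetric class of independent squares, and specialized morphisms are stable under independent pullbacks. Let 𝔹 be a stably oriented additive bivariant theory over this functoriality. Then there exists a unique orientation preserving Grothendieck transformation η : 𝔸 → 𝔹 from the universal additive bivariant theory 𝔸 to 𝔹. -/

import Mathlib

open CategoryTheory CategoryTheory.Limits

universe w w' u' v u

/-- A bivariant functoriality on a category `C` with a final object and all fiber
products: a class of confined morphisms (containing all isomorphisms, closed under
composition and pullback), a class of independent Cartesian squares (containing all
squares in which one pair of parallel sides consists of identities, closed under
horizontal and vertical composition) and a class of specialized morphisms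
(containing all isomorphisms and closed under composition).

A square is recorded by its bottom `bot : X ⟶ Y`, top `top : X' ⟶ Y'`, left
vertical `l : X' ⟶ X` and right vertical `r : Y' ⟶ Y`; it is Cartesian when
`IsPullback top l r bot` holds. -/
structure BivFun (C : Type u) [Category.{v} C] where
  pt : C
  isTerminal_pt : IsTerminal pt
  hasPullbacks : HasPullbacks C
  confined : ∀ ⦃X Y : C⦄, (X ⟶ Y) → Prop
  confined_of_isIso : ∀ ⦃X Y : C⦄ (f : X ⟶ Y), IsIso f → confined f
  confined_comp : ∀ ⦃X Y Z : C⦄ {f : X ⟶ Y} {g : Y ⟶ Z},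
    confined f → confined g → confined (f ≫ g)
  confined_pullback : ∀ ⦃X Y X' Y' : C⦄ {bot : X ⟶ Y} {top : X' ⟶ Y'} {l : X' ⟶ X}
    {r : Y' ⟶ Y}, IsPullback top l r bot → confined bot → confined top
  indep : ∀ ⦃X Y X' Y' : C⦄ (bot : X ⟶ Y) (top : X' ⟶ Y') (l : X' ⟶ X) (r : Y' ⟶ Y), Prop
  indep_isPullback : ∀ ⦃X Y X' Y' : C⦄ {bot : X ⟶ Y} {top : X' ⟶ Y'} {l : X' ⟶ X}
    {r : Y' ⟶ Y}, indep bot top l r → IsPullback top l r bot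
  indep_vert_id : ∀ ⦃X Y : C⦄ (f : X ⟶ Y), indep f f (𝟙 X) (𝟙 Y)
  indep_horiz_id : ∀ ⦃X Y : C⦄ (f : X ⟶ Y), indep (𝟙 Y) (𝟙 X) f f
  indep_vcomp : ∀ ⦃X Y X' Y' X'' Y'' : C⦄ {f : X ⟶ Y} {f' : X' ⟶ Y'} {f'' : X'' ⟶ Y''}
    {l : X' ⟶ X} {r : Y' ⟶ Y} {l' : X'' ⟶ X'} {r' : Y'' ⟶ Y'},
    indep f f' l r → indep f' f'' l' r' → indep f f'' (l' ≫ l) (r' ≫ r)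
  indep_hcomp : ∀ ⦃X Y Z X' Y' Z' : C⦄ {f : X ⟶ Y} {g : Y ⟶ Z} {f' : X' ⟶ Y'}
    {g' : Y' ⟶ Z'} {l : X' ⟶ X} {m : Y' ⟶ Y} {r : Z' ⟶ Z},
    indep f f' l m → indep g g' m r → indep (f ≫ g) (f' ≫ g') l r
  specialized : ∀ ⦃X Y : C⦄, (X ⟶ Y) → Prop
  specialized_of_isIso : ∀ ⦃X Y : C⦄ (f : X ⟶ Y), IsIso f → specialized f
  specialized_comp : ∀ ⦃X Y Z : C⦄ {f : X ⟶ Y} {g : Y ⟶ Z},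
    specialized f → specialized g → specialized (f ≫ g)

variable {C : Type u} [Category.{v} C]

/-- The structure morphism to the final object `pt`. -/
def BivFun.tm (F : BivFun C) (X : C) : X ⟶ F.pt := F.isTerminal_pt.from X

/-- The data of a bivariant theory with functoriality `F`: an abelian group for every
morphism, bivariant pushforwards along confined morphisms, bivariant pullbacks along
independent squares, bivariant products, and units. -/
structure BivData (F : BivFun C) where
  grp : ∀ ⦃X Y : C⦄, (X ⟶ Y) → Type w
  addCommGroup : ∀ ⦃X Y : C⦄ (f : X ⟶ Y), AddCommGroup (grp f)
  push : ∀ ⦃X X' Y : C⦄ (g : X ⟶ X') (h : X' ⟶ Y), F.confined g → grp (g ≫ h) → grp h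
  pull : ∀ ⦃X Y X' Y' : C⦄ {bot : X ⟶ Y} {top : X' ⟶ Y'} {l : X' ⟶ X} {r : Y' ⟶ Y},
    F.indep bot top l r → grp bot → grp top
  mul : ∀ ⦃X Y Z : C⦄ {f : X ⟶ Y} {g : Y ⟶ Z}, grp f → grp g → grp (f ≫ g)
  one : ∀ (X : C), grp (𝟙 X)

attribute [instance] BivData.addCommGroup

variable {F : BivFun C}

/-- Transport of bivariant elements along an equality of morphisms. -/
def BivData.tr (B : BivData.{w} F) {X Y : C} {f g : X ⟶ Y} (h : f = g) :
    B.grp f → B.grp g := fun a => h ▸ a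

/-- The Fulton–MacPherson bivariant axioms. -/
structure IsBivTheory (B : BivData.{w} F) : Prop where
  push_add : ∀ ⦃X X' Y : C⦄ (g : X ⟶ X') (h : X' ⟶ Y) (hg : F.confined g)
    (α β : B.grp (g ≫ h)), B.push g h hg (α + β) = B.push g h hg α + B.push g h hg β
  pull_add : ∀ ⦃X Y X' Y' : C⦄ {bot : X ⟶ Y} {top : X' ⟶ Y'} {l : X' ⟶ X} {r : Y' ⟶ Y}
    (hsq : F.indep bot top l r) (α β : B.grp bot),
    B.pull hsq (α + β) = B.pull hsq α + B.pull hsq β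
  mul_add_left : ∀ ⦃X Y Z : C⦄ {f : X ⟶ Y} {g : Y ⟶ Z} (α α' : B.grp f) (β : B.grp g),
    B.mul (α + α') β = B.mul α β + B.mul α' β
  mul_add_right : ∀ ⦃X Y Z : C⦄ {f : X ⟶ Y} {g : Y ⟶ Z} (α : B.grp f) (β β' : B.grp g),
    B.mul α (β + β') = B.mul α β + B.mul α β'
  mul_assoc : ∀ ⦃X Y Z W : C⦄ {f : X ⟶ Y} {g : Y ⟶ Z} {h : Z ⟶ W}
    (α : B.grp f) (β : B.grp g) (γ : B.grp h),
    B.mul (B.mul α β) γ = B.tr (Category.assoc f g h).symm (B.mul α (B.mul β γ))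
  push_id : ∀ ⦃X Y : C⦄ (f : X ⟶ Y) (h1 : F.confined (𝟙 X)) (α : B.grp (𝟙 X ≫ f)),
    B.push (𝟙 X) f h1 α = B.tr (Category.id_comp f) α
  push_comp : ∀ ⦃X X' X'' Y : C⦄ (f : X ⟶ X') (g : X' ⟶ X'') (h : X'' ⟶ Y)
    (hf : F.confined f) (hg : F.confined g) (α : B.grp (f ≫ g ≫ h)),
    B.push g h hg (B.push f (g ≫ h) hf α) =
      B.push (f ≫ g) h (F.confined_comp hf hg) (B.tr (Category.assoc f g h).symm α)
  pull_id : ∀ ⦃X Y : C⦄ (f : X ⟶ Y) (α : B.grp f), B.pull (F.indep_vert_id f) α = α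
  pull_comp : ∀ ⦃X Y X' Y' X'' Y'' : C⦄ {f : X ⟶ Y} {f' : X' ⟶ Y'} {f'' : X'' ⟶ Y''}
    {l : X' ⟶ X} {r : Y' ⟶ Y} {l' : X'' ⟶ X'} {r' : Y'' ⟶ Y'}
    (h1 : F.indep f f' l r) (h2 : F.indep f' f'' l' r') (α : B.grp f),
    B.pull h2 (B.pull h1 α) = B.pull (F.indep_vcomp h1 h2) α
  push_mul : ∀ ⦃X X' Y Z : C⦄ (f : X ⟶ X') (h : X' ⟶ Y) (g : Y ⟶ Z) (hf : F.confined f)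
    (α : B.grp (f ≫ h)) (β : B.grp g),
    B.push f (h ≫ g) hf (B.tr (Category.assoc f h g) (B.mul α β)) =
      B.mul (B.push f h hf α) β
  pull_mul : ∀ ⦃X Y Z X' Y' Z' : C⦄ {f : X ⟶ Y} {g : Y ⟶ Z} {f' : X' ⟶ Y'} {g' : Y' ⟶ Z'}
    {l : X' ⟶ X} {m : Y' ⟶ Y} {r : Z' ⟶ Z}
    (h1 : F.indep f f' l m) (h2 : F.indep g g' m r) (α : B.grp f) (β : B.grp g),
    B.pull (F.indep_hcomp h1 h2) (B.mul α β) = B.mul (B.pull h1 α) (B.pull h2 β)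
  push_pull : ∀ ⦃X Y Z X' Y' Z' : C⦄ (f : X ⟶ Y) (k : Y ⟶ Z) (f' : X' ⟶ Y') (k' : Y' ⟶ Z')
    (l : X' ⟶ X) (m : Y' ⟶ Y) (r : Z' ⟶ Z) (hf : F.confined f)
    (hleft : IsPullback f' l m f) (hbig : F.indep (f ≫ k) (f' ≫ k') l r)
    (hright : F.indep k k' m r) (α : B.grp (f ≫ k)),
    B.pull hright (B.push f k hf α) =
      B.push f' k' (F.confined_pullback hleft hf) (B.pull hbig α)
  proj_formula : ∀ ⦃X Y X' Y' Z : C⦄ {b : X' ⟶ Y'} {t : X ⟶ Y} {g' : X ⟶ X'} {g : Y ⟶ Y'}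
    (hsq : F.indep b t g' g) (hg : F.confined g) (c : Y' ⟶ Z)
    (α : B.grp (g ≫ c)) (β : B.grp b),
    B.push g' (b ≫ c) (F.confined_pullback (F.indep_isPullback hsq).flip hg)
        (B.tr (by rw [← Category.assoc, (F.indep_isPullback hsq).w, Category.assoc])
          (B.mul (B.pull hsq β) α)) =
      B.mul β (B.push g c hg α)
  one_mul : ∀ ⦃X Y : C⦄ {f : X ⟶ Y} (α : B.grp f),
    B.tr (Category.id_comp f) (B.mul (B.one X) α) = α
  mul_one : ∀ ⦃X Y : C⦄ {f : X ⟶ Y} (α : B.grp f),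
    B.tr (Category.comp_id f) (B.mul α (B.one Y)) = α

/-- The cohomology pullback `f^* : 𝔹^•(Y) → 𝔹^•(X)` along an arbitrary morphism, using
the independent square whose horizontal sides are `f` and whose vertical sides are
identities. -/
def cohPull (B : BivData.{w} F) {X Y : C} (f : X ⟶ Y) : B.grp (𝟙 Y) → B.grp (𝟙 X) :=
  B.pull (F.indep_horiz_id f)

/-- The ring multiplication on the cohomology `𝔹^•(X) = 𝔹(𝟙 X)`. -/
def cohMul (B : BivData.{w} F) {X : C} (α β : B.grp (𝟙 X)) : B.grp (𝟙 X) :=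
  B.tr (Category.id_comp (𝟙 X)) (B.mul α β)

/-- The homology pushforward `f_* : 𝔹_•(X) → 𝔹_•(Y)` along a confined morphism. -/
def homPush (B : BivData.{w} F) {X Y : C} (f : X ⟶ Y) (hf : F.confined f) :
    B.grp (F.tm X) → B.grp (F.tm Y) :=
  fun a => B.push f (F.tm Y) hf (B.tr (F.isTerminal_pt.hom_ext _ _) a)

/-- The left action of the cohomology ring `𝔹^•(X)` on the homology `𝔹_•(X)`. -/
def cohSmul (B : BivData.{w} F) {X : C} (α : B.grp (𝟙 X)) (a : B.grp (F.tm X)) :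
    B.grp (F.tm X) :=
  B.tr (Category.id_comp (F.tm X)) (B.mul α a)

/-- An orientation of a bivariant theory: a canonical element `θ(f)` for every
specialized morphism, normalized and multiplicative. -/
structure BivOrientation (B : BivData.{w} F) where
  θ : ∀ ⦃X Y : C⦄ (f : X ⟶ Y), F.specialized f → B.grp f
  θ_id : ∀ (X : C), θ (𝟙 X) (F.specialized_of_isIso (𝟙 X) inferInstance) = B.one X
  θ_comp : ∀ ⦃X Y Z : C⦄ (f : X ⟶ Y) (g : Y ⟶ Z) (hf : F.specialized f)
    (hg : F.specialized g),
    θ (f ≫ g) (F.specialized_comp hf hg) = B.mul (θ f hf) (θ g hg)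

/-- A stable orientation: specialized morphisms are stable under independent
pullbacks, and the orientation is stable under independent pullbacks. -/
structure StableOrientation (B : BivData.{w} F) extends BivOrientation B where
  specialized_pullback : ∀ ⦃X Y X' Y' : C⦄ {bot : X ⟶ Y} {top : X' ⟶ Y'} {l : X' ⟶ X}
    {r : Y' ⟶ Y}, F.indep bot top l r → F.specialized bot → F.specialized top
  θ_pullback : ∀ ⦃X Y X' Y' : C⦄ {bot : X ⟶ Y} {top : X' ⟶ Y'} {l : X' ⟶ X}
    {r : Y' ⟶ Y} (hsq : F.indep bot top l r) (hs : F.specialized bot),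
    B.pull hsq (θ bot hs) = θ top (specialized_pullback hsq hs)

variable {B : BivData.{w} F}

/-- The Gysin pushforward `f_! : 𝔹^•(X) → 𝔹^•(Y)`, `f_!(α) = f_*(α • θ(f))`, along a
confined and specialized morphism. -/
def BivOrientation.gysinPush (O : BivOrientation B) {X Y : C} (f : X ⟶ Y)
    (hc : F.confined f) (hs : F.specialized f) : B.grp (𝟙 X) → B.grp (𝟙 Y) :=
  fun α => B.push f (𝟙 Y) hc
    (B.tr (show 𝟙 X ≫ f = f ≫ 𝟙 Y by simp) (B.mul α (O.θ f hs)))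

/-- The Gysin pullback `g^! : 𝔹_•(Y) → 𝔹_•(X)`, `g^!(β) = θ(g) • β`, along a
specialized morphism. -/
def BivOrientation.gysinPull (O : BivOrientation B) {X Y : C} (g : X ⟶ Y)
    (hs : F.specialized g) : B.grp (F.tm Y) → B.grp (F.tm X) :=
  fun a => B.tr (F.isTerminal_pt.hom_ext _ _) (B.mul (O.θ g hs) a)

/-- A Grothendieck transformation between two bivariant theories on the same
functoriality: a family of group homomorphisms commuting with bivariant
pushforwards, pullbacks and products. -/
structure GrothTrans (B₁ : BivData.{w} F) (B₂ : BivData.{w'} F) where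
  map : ∀ ⦃X Y : C⦄ (f : X ⟶ Y), B₁.grp f →+ B₂.grp f
  map_push : ∀ ⦃X X' Y : C⦄ (g : X ⟶ X') (h : X' ⟶ Y) (hg : F.confined g)
    (α : B₁.grp (g ≫ h)),
    map h (B₁.push g h hg α) = B₂.push g h hg (map (g ≫ h) α)
  map_pull : ∀ ⦃X Y X' Y' : C⦄ {bot : X ⟶ Y} {top : X' ⟶ Y'} {l : X' ⟶ X}
    {r : Y' ⟶ Y} (hsq : F.indep bot top l r) (α : B₁.grp bot),
    map top (B₁.pull hsq α) = B₂.pull hsq (map bot α)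
  map_mul : ∀ ⦃X Y Z : C⦄ {f : X ⟶ Y} {g : Y ⟶ Z} (α : B₁.grp f) (β : B₁.grp g),
    map (f ≫ g) (B₁.mul α β) = B₂.mul (map f α) (map g β)

/-- `f : X ⟶ S` is a canonical inclusion into a (binary) coproduct. -/
def IsCoprodIncl {X S : C} (f : X ⟶ S) : Prop :=
  ∃ (Y : C) (g : Y ⟶ S),
    Nonempty (IsColimit (BinaryCofan.mk f g)) ∨ Nonempty (IsColimit (BinaryCofan.mk g f))

/-- The bivariant functoriality has good coproducts: `𝒞` has finite coproducts; no
non-initial object maps to an initial object; a morphism out of a coproduct is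
confined (resp. specialized) iff both of its restrictions are; the squares expressing
disjointness of the canonical inclusions and the base change of a coproduct
decomposition are Cartesian; and every Cartesian square having a canonical coproduct
inclusion as a side is independent. -/
structure GoodCoproducts (F : BivFun C) : Prop where
  hasInitial : HasInitial C
  hasBinaryCoproducts : HasBinaryCoproducts C
  no_map_to_initial : ∀ ⦃X E : C⦄, IsInitial E → (X ⟶ E) → Nonempty (IsInitial X)
  confined_iff : ∀ ⦃X Y S Z : C⦄ (ι₁ : X ⟶ S) (ι₂ : Y ⟶ S),
    Nonempty (IsColimit (BinaryCofan.mk ι₁ ι₂)) → ∀ (f : S ⟶ Z),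
    (F.confined f ↔ F.confined (ι₁ ≫ f) ∧ F.confined (ι₂ ≫ f))
  specialized_iff : ∀ ⦃X Y S Z : C⦄ (ι₁ : X ⟶ S) (ι₂ : Y ⟶ S),
    Nonempty (IsColimit (BinaryCofan.mk ι₁ ι₂)) → ∀ (f : S ⟶ Z),
    (F.specialized f ↔ F.specialized (ι₁ ≫ f) ∧ F.specialized (ι₂ ≫ f))
  disjoint_cartesian : ∀ ⦃X Y S E : C⦄ (ι₁ : X ⟶ S) (ι₂ : Y ⟶ S),
    Nonempty (IsColimit (BinaryCofan.mk ι₁ ι₂)) → ∀ (hE : IsInitial E),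
    IsPullback (hE.to X) (hE.to Y) ι₁ ι₂
  basechange_cartesian : ∀ ⦃X Y S Z Z' X' Y' S' : C⦄ (ι₁ : X ⟶ S) (ι₂ : Y ⟶ S),
    Nonempty (IsColimit (BinaryCofan.mk ι₁ ι₂)) →
    ∀ (f : S ⟶ Z) (g : Z' ⟶ Z) (pX : X' ⟶ X) (qX : X' ⟶ Z') (pY : Y' ⟶ Y)
      (qY : Y' ⟶ Z'),
    IsPullback qX pX g (ι₁ ≫ f) → IsPullback qY pY g (ι₂ ≫ f) →
    ∀ (ι₁' : X' ⟶ S') (ι₂' : Y' ⟶ S'),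
    Nonempty (IsColimit (BinaryCofan.mk ι₁' ι₂')) →
    ∀ (t : S' ⟶ Z') (l : S' ⟶ S), ι₁' ≫ t = qX → ι₂' ≫ t = qY →
      ι₁' ≫ l = pX ≫ ι₁ → ι₂' ≫ l = pY ≫ ι₂ → IsPullback t l g f
  incl_indep : ∀ ⦃X Y X' Y' : C⦄ {bot : X ⟶ Y} {top : X' ⟶ Y'} {l : X' ⟶ X}
    {r : Y' ⟶ Y}, IsPullback top l r bot →
    (IsCoprodIncl bot ∨ IsCoprodIncl top ∨ IsCoprodIncl l ∨ IsCoprodIncl r) →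
    F.indep bot top l r

/-- A well oriented and additive bivariant theory over a functoriality with good
coproducts: the orientations of the canonical coproduct inclusions are stable under
independent pullbacks, and for every finite coproduct `X = ⨿ᵢ Xᵢ` with canonical
inclusions `ιᵢ` (which are confined and specialized) one has
`Σᵢ ιᵢ_*(θ(ιᵢ)) = 1_X`. -/
structure IsAdditive (B : BivData.{w} F) (O : BivOrientation B)
    (D : GoodCoproducts F) : Prop where
  well_oriented : ∀ ⦃X Y X' Y' : C⦄ {bot : X ⟶ Y} {top : X' ⟶ Y'} {l : X' ⟶ X}
    {r : Y' ⟶ Y} (hsq : F.indep bot top l r), IsCoprodIncl bot →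
    ∀ (hbs : F.specialized bot) (hts : F.specialized top),
    B.pull hsq (O.θ bot hbs) = O.θ top hts
  additive : ∀ (n : ℕ) (Xs : Fin n → C) (S : C) (ι : ∀ i, Xs i ⟶ S),
    Nonempty (IsColimit (Cofan.mk S ι)) →
    ∀ (hc : ∀ i, F.confined (ι i)) (hs : ∀ i, F.specialized (ι i)),
    (Finset.univ.sum fun i =>
      B.push (ι i) (𝟙 S) (hc i)
        (B.tr (Category.comp_id (ι i)).symm (O.θ (ι i) (hs i)))) = B.one S

/-- `𝒞`-independence, part 1: every Cartesian square whose right-hand vertical side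
is confined is independent. -/
def CIndepRight (F : BivFun C) : Prop :=
  ∀ ⦃X Y X' Y' : C⦄ {bot : X ⟶ Y} {top : X' ⟶ Y'} {l : X' ⟶ X} {r : Y' ⟶ Y},
    IsPullback top l r bot → F.confined r → F.indep bot top l r

/-- `𝒞`-independence, part 2: every Cartesian square whose bottom horizontal side is
confined is independent. -/
def CIndepBot (F : BivFun C) : Prop :=
  ∀ ⦃X Y X' Y' : C⦄ {bot : X ⟶ Y} {top : X' ⟶ Y'} {l : X' ⟶ X} {r : Y' ⟶ Y},
    IsPullback top l r bot → F.confined bot → F.indep bot top l r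

/-- The class of independent squares is symmetric: independence of a square implies
independence of its transpose. -/
def IndepSymm (F : BivFun C) : Prop :=
  ∀ ⦃X Y X' Y' : C⦄ {bot : X ⟶ Y} {top : X' ⟶ Y'} {l : X' ⟶ X} {r : Y' ⟶ Y},
    F.indep bot top l r → F.indep r l top bot

/-- Specialized morphisms are stable under independent pullbacks. -/
def SpecStable (F : BivFun C) : Prop :=
  ∀ ⦃X Y X' Y' : C⦄ {bot : X ⟶ Y} {top : X' ⟶ Y'} {l : X' ⟶ X} {r : Y' ⟶ Y},
    F.indep bot top l r → F.specialized bot → F.specialized top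

/-- A bivariant theory (with a symmetric class of independent squares) is commutative
if `g^*(α) • β = f^*(β) • α` for every independent square with bottom `f` and right
side `g`, where `f^*` is the pullback along the transposed square. -/
def IsCommutative (B : BivData.{w} F) : Prop :=
  ∀ ⦃X Y X' Y' : C⦄ {f : X ⟶ Y} {top : X' ⟶ Y'} {l : X' ⟶ X} {g : Y' ⟶ Y}
    (hsq : F.indep f top l g) (hsq' : F.indep g l top f)
    (α : B.grp f) (β : B.grp g),
    B.mul (B.pull hsq α) β =
      B.tr (F.indep_isPullback hsq).w.symm (B.mul (B.pull hsq' β) α)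

/-- A bivariant cycle over `φ : X ⟶ Y`: a confined morphism `m : V ⟶ X` such that the
composite `V ⟶ Y` is specialized. -/
structure PreCyc (F : BivFun C) {X Y : C} (φ : X ⟶ Y) : Type max u v where
  V : C
  m : V ⟶ X
  conf : F.confined m
  spec : F.specialized (m ≫ φ)

/-- Two cycles are isomorphic when there is an isomorphism of their sources commuting
with the structure morphisms. -/
def CycIso {F : BivFun C} {X Y : C} {φ : X ⟶ Y} (c c' : PreCyc F φ) : Prop :=
  ∃ e : c.V ≅ c'.V, e.hom ≫ c'.m = c.m

/-- A presentation of the universal bivariant theory `𝕄`: the groups `𝕄(X → Y)` are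
free on the isomorphism classes of cycles `[V → X]` (expressed by the universal
property `free`), and the bivariant operations act on cycle classes by the standard
formulas: pushforward relabels, pullback takes a base change, the product takes the
double fiber product, and the unit is the identity cycle. -/
structure MPresentation (M : BivData.{w} F) where
  cls : ∀ ⦃X Y : C⦄ {φ : X ⟶ Y}, PreCyc F φ → M.grp φ
  cls_iso : ∀ ⦃X Y : C⦄ {φ : X ⟶ Y} (c c' : PreCyc F φ), CycIso c c' → cls c = cls c'
  free : ∀ ⦃X Y : C⦄ (φ : X ⟶ Y) (H : Type w') [AddCommGroup H]
    (v : PreCyc F φ → H), (∀ c c', CycIso c c' → v c = v c') →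
    ∃! ψ : M.grp φ →+ H, ∀ c, ψ (cls c) = v c
  cls_push : ∀ ⦃X X' Y : C⦄ (g : X ⟶ X') (φ : X' ⟶ Y) (hg : F.confined g)
    (c : PreCyc F (g ≫ φ)),
    M.push g φ hg (cls c) =
      cls ⟨c.V, c.m ≫ g, F.confined_comp c.conf hg,
        (Category.assoc c.m g φ).symm ▸ c.spec⟩
  cls_pull : ∀ ⦃X Y X' Y' : C⦄ {bot : X ⟶ Y} {top : X' ⟶ Y'} {l : X' ⟶ X}
    {r : Y' ⟶ Y} (hsq : F.indep bot top l r) (c : PreCyc F bot)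
    (V' : C) (pr : V' ⟶ c.V) (m' : V' ⟶ X') (hpb : IsPullback m' pr l c.m)
    (hspec : F.specialized (m' ≫ top)),
    M.pull hsq (cls c) = cls ⟨V', m', F.confined_pullback hpb c.conf, hspec⟩
  cls_mul : ∀ ⦃X Y Z : C⦄ {φ : X ⟶ Y} {ψ : Y ⟶ Z} (c : PreCyc F φ) (d : PreCyc F ψ)
    (X' : C) (a : X' ⟶ X) (b : X' ⟶ d.V) (hX' : IsPullback a b φ d.m)
    (V' : C) (uu : V' ⟶ c.V) (ww : V' ⟶ X') (hV' : IsPullback uu ww c.m a)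
    (hconf : F.confined (ww ≫ a)) (hspec : F.specialized ((ww ≫ a) ≫ (φ ≫ ψ))),
    M.mul (cls c) (cls d) = cls ⟨V', ww ≫ a, hconf, hspec⟩
  cls_one : ∀ X : C,
    M.one X = cls ⟨X, 𝟙 X, F.confined_of_isIso (𝟙 X) inferInstance,
      F.specialized_of_isIso (𝟙 X ≫ 𝟙 X) inferInstance⟩

/-- The canonical orientation `θ(f) = [X = X]` of the universal bivariant theory. -/
def MPresentation.thetaEl {M : BivData.{w} F} (P : MPresentation.{w, w'} M)
    {X Y : C} (f : X ⟶ Y) (hs : F.specialized f) : M.grp f :=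
  P.cls ⟨X, 𝟙 X, F.confined_of_isIso (𝟙 X) inferInstance, by simpa using hs⟩

/-- The decomposition relation between cycles: `c` decomposes as the disjoint union
of `c₁` and `c₂` via canonical coproduct inclusions compatible with the structure
morphisms. -/
def DecompRel {F : BivFun C} {X Y : C} {φ : X ⟶ Y} (c c₁ c₂ : PreCyc F φ) : Prop :=
  ∃ (κ₁ : c₁.V ⟶ c.V) (κ₂ : c₂.V ⟶ c.V),
    Nonempty (IsColimit (BinaryCofan.mk κ₁ κ₂)) ∧ κ₁ ≫ c.m = c₁.m ∧ κ₂ ≫ c.m = c₂.m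

/-- A presentation of the universal additive bivariant theory `𝔸`: the groups
`𝔸(X → Y)` are free on the isomorphism classes of cycles `[V → X]` modulo the
decomposition relations `[V₁ ⊔ V₂ → X] = [V₁ → X] + [V₂ → X]` (expressed by the
universal property `free`), and the bivariant operations act on cycle classes by the
standard formulas. -/
structure AddPresentation (A : BivData.{w} F) where
  cls : ∀ ⦃X Y : C⦄ {φ : X ⟶ Y}, PreCyc F φ → A.grp φ
  cls_iso : ∀ ⦃X Y : C⦄ {φ : X ⟶ Y} (c c' : PreCyc F φ), CycIso c c' → cls c = cls c'
  cls_decomp : ∀ ⦃X Y : C⦄ {φ : X ⟶ Y} (c c₁ c₂ : PreCyc F φ), DecompRel c c₁ c₂ →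
    cls c = cls c₁ + cls c₂
  free : ∀ ⦃X Y : C⦄ (φ : X ⟶ Y) (H : Type w') [AddCommGroup H]
    (v : PreCyc F φ → H), (∀ c c', CycIso c c' → v c = v c') →
    (∀ c c₁ c₂, DecompRel c c₁ c₂ → v c = v c₁ + v c₂) →
    ∃! ψ : A.grp φ →+ H, ∀ c, ψ (cls c) = v c
  cls_push : ∀ ⦃X X' Y : C⦄ (g : X ⟶ X') (φ : X' ⟶ Y) (hg : F.confined g)
    (c : PreCyc F (g ≫ φ)),
    A.push g φ hg (cls c) =
      cls ⟨c.V, c.m ≫ g, F.confined_comp c.conf hg,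
        (Category.assoc c.m g φ).symm ▸ c.spec⟩
  cls_pull : ∀ ⦃X Y X' Y' : C⦄ {bot : X ⟶ Y} {top : X' ⟶ Y'} {l : X' ⟶ X}
    {r : Y' ⟶ Y} (hsq : F.indep bot top l r) (c : PreCyc F bot)
    (V' : C) (pr : V' ⟶ c.V) (m' : V' ⟶ X') (hpb : IsPullback m' pr l c.m)
    (hspec : F.specialized (m' ≫ top)),
    A.pull hsq (cls c) = cls ⟨V', m', F.confined_pullback hpb c.conf, hspec⟩
  cls_mul : ∀ ⦃X Y Z : C⦄ {φ : X ⟶ Y} {ψ : Y ⟶ Z} (c : PreCyc F φ) (d : PreCyc F ψ)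
    (X' : C) (a : X' ⟶ X) (b : X' ⟶ d.V) (hX' : IsPullback a b φ d.m)
    (V' : C) (uu : V' ⟶ c.V) (ww : V' ⟶ X') (hV' : IsPullback uu ww c.m a)
    (hconf : F.confined (ww ≫ a)) (hspec : F.specialized ((ww ≫ a) ≫ (φ ≫ ψ))),
    A.mul (cls c) (cls d) = cls ⟨V', ww ≫ a, hconf, hspec⟩
  cls_one : ∀ X : C,
    A.one X = cls ⟨X, 𝟙 X, F.confined_of_isIso (𝟙 X) inferInstance,
      F.specialized_of_isIso (𝟙 X ≫ 𝟙 X) inferInstance⟩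

/-- The canonical orientation `θ(f) = [X = X]` of the universal additive bivariant
theory. -/
def AddPresentation.thetaEl {A : BivData.{w} F} (P : AddPresentation.{w, w'} A)
    {X Y : C} (f : X ⟶ Y) (hs : F.specialized f) : A.grp f :=
  P.cls ⟨X, 𝟙 X, F.confined_of_isIso (𝟙 X) inferInstance, by simpa using hs⟩

namespace BivData

theorem tr_tr (B : BivData.{w} F) {X Y : C} {f g k : X ⟶ Y} (h : f = g) (h' : g = k)
    (α : B.grp f) : B.tr h' (B.tr h α) = B.tr (h.trans h') α := by
  subst h h'; rfl

theorem push_tr (B : BivData.{w} F) {X X' Y : C} {g : X ⟶ X'} {h h' : X' ⟶ Y} (e : h = h')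
    (hg : F.confined g) (α : B.grp (g ≫ h)) :
    B.tr e (B.push g h hg α) = B.push g h' hg (B.tr (by rw [e]) α) := by
  subst e; rfl

theorem tr_mul_left (B : BivData.{w} F) {X Y Z : C} {f f' : X ⟶ Y} {g : Y ⟶ Z} (e : f = f')
    (α : B.grp f) (β : B.grp g) :
    B.mul (B.tr e α) β = B.tr (by rw [e]) (B.mul α β) := by
  subst e; rfl

/-- Bivariant pushforward as a homomorphism of abelian groups. -/
def pushHom (B : BivData.{w} F) (hB : IsBivTheory B) {X X' Y : C} (g : X ⟶ X') (h : X' ⟶ Y)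
    (hg : F.confined g) : B.grp (g ≫ h) →+ B.grp h :=
  AddMonoidHom.mk' (B.push g h hg) (hB.push_add g h hg)

/-- Bivariant pullback as a homomorphism of abelian groups. -/
def pullHom (B : BivData.{w} F) (hB : IsBivTheory B) {X Y X' Y' : C} {bot : X ⟶ Y}
    {top : X' ⟶ Y'} {l : X' ⟶ X} {r : Y' ⟶ Y} (hsq : F.indep bot top l r) :
    B.grp bot →+ B.grp top :=
  AddMonoidHom.mk' (B.pull hsq) (hB.pull_add hsq)

/-- The bivariant product as a biadditive map. -/
def mulHom (B : BivData.{w} F) (hB : IsBivTheory B) {X Y Z : C} (f : X ⟶ Y) (g : Y ⟶ Z) :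
    B.grp f →+ B.grp g →+ B.grp (f ≫ g) :=
  AddMonoidHom.mk' (fun α => AddMonoidHom.mk' (B.mul α) (hB.mul_add_right α))
    fun α α' => by ext β; exact hB.mul_add_left α α' β

/-- Transport along an equality of morphisms as a homomorphism of abelian groups. -/
def trHom (B : BivData.{w} F) {X Y : C} {f g : X ⟶ Y} (h : f = g) : B.grp f →+ B.grp g :=
  AddMonoidHom.mk' (B.tr h) fun _ _ => by subst h; rfl

end BivData

theorem BivOrientation.tr_θ (O : BivOrientation B) {X Y : C} {f g : X ⟶ Y} (h : f = g)
    (hf : F.specialized f) (hg : F.specialized g) : B.tr h (O.θ f hf) = O.θ g hg := by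
  subst h; rfl

theorem GrothTrans.ext_map {B₁ : BivData.{w} F} {B₂ : BivData.{w'} F} {η η' : GrothTrans B₁ B₂}
    (h : ∀ ⦃X Y : C⦄ (f : X ⟶ Y), η.map f = η'.map f) : η = η' := by
  have : η.map = η'.map := by funext X Y f; exact h f
  cases η; cases η'; congr

/-- In an additive theory, the orientation of a morphism out of a finite coproduct is the sum of
the pushforwards of the orientations of its restrictions. -/
theorem IsAdditive.θ_eq_sum {O : BivOrientation B} {D : GoodCoproducts F} (hAdd : IsAdditive B O D)
    (hB : IsBivTheory B) {n : ℕ} {Xs : Fin n → C} {S Y : C} (ι : ∀ i, Xs i ⟶ S)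
    (hS : Nonempty (IsColimit (Cofan.mk S ι))) (hc : ∀ i, F.confined (ι i))
    (hs : ∀ i, F.specialized (ι i)) (f : S ⟶ Y) (hf : F.specialized f) :
    O.θ f hf = ∑ i, B.push (ι i) f (hc i) (O.θ (ι i ≫ f) (F.specialized_comp (hs i) hf)) := by
  have h1 : O.θ f hf = B.trHom (Category.id_comp f)
      ((B.mulHom hB (𝟙 S) f).flip (O.θ f hf) (B.one S)) := (hB.one_mul _).symm
  rw [h1, ← hAdd.additive n Xs S ι hS hc hs, map_sum, map_sum]
  refine Finset.sum_congr rfl fun i _ => ?_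
  change B.tr _ (B.mul (B.push (ι i) (𝟙 S) _ _) (O.θ f hf)) = _
  rw [← hB.push_mul, B.push_tr (Category.id_comp f), B.tr_mul_left, ← O.θ_comp _ _ (hs i) hf,
    B.tr_tr, B.tr_tr, O.tr_θ]

theorem IsAdditive.push_θ_of_iso {O : BivOrientation B} {D : GoodCoproducts F}
    (hAdd : IsAdditive B O D) (hB : IsBivTheory B) {X S Y : C} (e : X ≅ S) (f : S ⟶ Y)
    (hf : F.specialized f) (hc : F.confined e.hom) (hef : F.specialized (e.hom ≫ f)) :
    B.push e.hom f hc (O.θ (e.hom ≫ f) hef) = O.θ f hf := by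
  have hS : IsColimit (Cofan.mk S fun _ : Fin 1 => e.hom) :=
    Cofan.IsColimit.mk _ (fun s => e.inv ≫ s.inj 0)
      (fun s j => by fin_cases j; simp [Cofan.inj])
      (fun s m hm => by rw [← hm 0]; simp [Cofan.inj])
  rw [hAdd.θ_eq_sum hB _ ⟨hS⟩ (fun _ => hc)
    (fun _ => F.specialized_of_isIso e.hom inferInstance) f hf, Fin.sum_univ_one]

theorem IsAdditive.θ_eq_add {O : BivOrientation B} {D : GoodCoproducts F}
    (hAdd : IsAdditive B O D) (hB : IsBivTheory B) {X₁ X₂ S Y : C} (κ₁ : X₁ ⟶ S) (κ₂ : X₂ ⟶ S)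
    (hS : IsColimit (BinaryCofan.mk κ₁ κ₂)) (f : S ⟶ Y) (hf : F.specialized f)
    (hc₁ : F.confined κ₁) (hc₂ : F.confined κ₂) (hs₁ : F.specialized (κ₁ ≫ f))
    (hs₂ : F.specialized (κ₂ ≫ f)) :
    O.θ f hf = B.push κ₁ f hc₁ (O.θ (κ₁ ≫ f) hs₁) + B.push κ₂ f hc₂ (O.θ (κ₂ ≫ f) hs₂) := by
  let Xs : Fin 2 → C := Fin.cons X₁ fun _ => X₂
  let ι : ∀ i, Xs i ⟶ S := Fin.cons κ₁ fun _ => κ₂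
  have hS' : IsColimit (Cofan.mk S ι) :=
    Cofan.IsColimit.mk _ (fun s => BinaryCofan.IsColimit.desc hS (s.inj 0) (s.inj 1))
      (fun s j => by
        fin_cases j
        · exact hS.fac (BinaryCofan.mk (s.inj 0) (s.inj 1)) ⟨WalkingPair.left⟩
        · exact hS.fac (BinaryCofan.mk (s.inj 0) (s.inj 1)) ⟨WalkingPair.right⟩)
      (fun s m hm => by
        apply BinaryCofan.IsColimit.hom_ext hS
        · exact (hm 0).trans
            (hS.fac (BinaryCofan.mk (s.inj 0) (s.inj 1)) ⟨WalkingPair.left⟩).symm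
        · exact (hm 1).trans
            (hS.fac (BinaryCofan.mk (s.inj 0) (s.inj 1)) ⟨WalkingPair.right⟩).symm)
  have hs := (D.specialized_iff κ₁ κ₂ ⟨hS⟩ (𝟙 S)).1 (F.specialized_of_isIso _ inferInstance)
  simp only [Category.comp_id] at hs
  rw [hAdd.θ_eq_sum hB ι ⟨hS'⟩ (Fin.cons hc₁ fun _ => hc₂) (Fin.cons hs.1 fun _ => hs.2) f hf,
    Fin.sum_univ_two]
  rfl

/-- The image `m_*(θ(m ≫ φ))` of a cycle `m : V ⟶ X` in an oriented bivariant theory. -/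
def BivOrientation.cycleClass (O : BivOrientation B) {X Y : C} {φ : X ⟶ Y} (c : PreCyc F φ) :
    B.grp φ :=
  B.push c.m φ c.conf (O.θ (c.m ≫ φ) c.spec)

theorem BivOrientation.cycleClass_comp (O : BivOrientation B) (hB : IsBivTheory B)
    {V X X' Y : C} (m : V ⟶ X) (g : X ⟶ X') (φ : X' ⟶ Y) (hm : F.confined m) (hg : F.confined g)
    (hs : F.specialized (m ≫ g ≫ φ)) (hs' : F.specialized ((m ≫ g) ≫ φ)) :
    B.push g φ hg (B.push m (g ≫ φ) hm (O.θ (m ≫ g ≫ φ) hs)) =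
      O.cycleClass ⟨V, m ≫ g, F.confined_comp hm hg, hs'⟩ := by
  rw [hB.push_comp, O.tr_θ]; rfl

theorem IsAdditive.cycleClass_iso {O : BivOrientation B} {D : GoodCoproducts F}
    (hAdd : IsAdditive B O D) (hB : IsBivTheory B) {X Y : C} {φ : X ⟶ Y} (c c' : PreCyc F φ)
    (h : CycIso c c') : O.cycleClass c = O.cycleClass c' := by
  obtain ⟨V, m, hm, hs⟩ := c
  obtain ⟨e, he⟩ := h
  dsimp only at e he
  subst he
  have hc := F.confined_of_isIso e.hom inferInstance
  have hs' : F.specialized (e.hom ≫ c'.m ≫ φ) := by rwa [← Category.assoc]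
  rw [← O.cycleClass_comp hB e.hom c'.m φ hc c'.conf hs' hs,
    hAdd.push_θ_of_iso hB e _ c'.spec]
  rfl

theorem IsAdditive.cycleClass_decomp {O : BivOrientation B} {D : GoodCoproducts F}
    (hAdd : IsAdditive B O D) (hB : IsBivTheory B) {X Y : C} {φ : X ⟶ Y}
    (c c₁ c₂ : PreCyc F φ) (h : DecompRel c c₁ c₂) :
    O.cycleClass c = O.cycleClass c₁ + O.cycleClass c₂ := by
  obtain ⟨V₁, m₁, hm₁, hs₁⟩ := c₁
  obtain ⟨V₂, m₂, hm₂, hs₂⟩ := c₂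
  obtain ⟨κ₁, κ₂, ⟨hS⟩, h₁, h₂⟩ := h
  dsimp only at κ₁ κ₂ hS h₁ h₂
  subst h₁ h₂
  have hκ := (D.confined_iff κ₁ κ₂ ⟨hS⟩ (𝟙 _)).1 (F.confined_of_isIso _ inferInstance)
  simp only [Category.comp_id] at hκ
  have hs₁' : F.specialized (κ₁ ≫ c.m ≫ φ) := by rwa [← Category.assoc]
  have hs₂' : F.specialized (κ₂ ≫ c.m ≫ φ) := by rwa [← Category.assoc]
  rw [← O.cycleClass_comp hB κ₁ c.m φ hκ.1 c.conf hs₁' hs₁,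
    ← O.cycleClass_comp hB κ₂ c.m φ hκ.2 c.conf hs₂' hs₂, ← hB.push_add,
    ← hAdd.θ_eq_add hB κ₁ κ₂ hS _ c.spec]
  rfl

theorem StableOrientation.pull_cycleClass (O : StableOrientation B) (hB : IsBivTheory B)
    (hCIb : CIndepBot F) {X Y X' Y' : C} {bot : X ⟶ Y} {top : X' ⟶ Y'} {l : X' ⟶ X} {r : Y' ⟶ Y}
    (hsq : F.indep bot top l r) (c : PreCyc F bot) {V' : C} {pr : V' ⟶ c.V} {m' : V' ⟶ X'}
    (hpb : IsPullback m' pr l c.m) (hspec : F.specialized (m' ≫ top)) :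
    B.pull hsq (O.cycleClass c) =
      O.cycleClass ⟨V', m', F.confined_pullback hpb c.conf, hspec⟩ := by
  unfold BivOrientation.cycleClass
  rw [hB.push_pull c.m bot m' top pr l r c.conf hpb
    (F.indep_hcomp (hCIb hpb c.conf) hsq) hsq, O.θ_pullback]

theorem StableOrientation.mul_cycleClass (O : StableOrientation B) (hB : IsBivTheory B)
    (hCIr : CIndepRight F) (hCIb : CIndepBot F) {X Y Z : C} {φ : X ⟶ Y} {ψ : Y ⟶ Z}
    (c : PreCyc F φ) (d : PreCyc F ψ) {X' : C} {a : X' ⟶ X} {b : X' ⟶ d.V}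
    (hX' : IsPullback a b φ d.m) {V' : C} {uu : V' ⟶ c.V} {ww : V' ⟶ X'}
    (hV' : IsPullback uu ww c.m a) (hconf : F.confined (ww ≫ a))
    (hspec : F.specialized ((ww ≫ a) ≫ φ ≫ ψ)) :
    B.mul (O.cycleClass c) (O.cycleClass d) = O.cycleClass ⟨V', ww ≫ a, hconf, hspec⟩ := by
  have hsq : F.indep φ b a d.m := hCIr hX'.flip d.conf
  have ha : F.confined a := F.confined_pullback hX' d.conf
  have hww : F.confined ww := F.confined_pullback hV'.flip c.conf
  have hs : F.specialized (ww ≫ b) :=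
    O.specialized_pullback (F.indep_hcomp (hCIb hV'.flip c.conf) hsq) c.spec
  have hs' : F.specialized (ww ≫ a ≫ φ ≫ ψ) := by rwa [← Category.assoc]
  rw [← O.cycleClass_comp hB ww a (φ ≫ ψ) hww ha hs' hspec]
  change B.mul _ (B.push d.m ψ d.conf _) = _
  rw [← hB.proj_formula hsq d.conf ψ, O.pull_cycleClass hB hCIb hsq c hV'.flip hs]
  change B.push a _ _ (B.tr _ (B.mul (B.push ww b _ _) _)) = _
  rw [← hB.push_mul, ← O.θ_comp _ _ hs d.spec, O.tr_θ _ _ (by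
    rw [← Category.assoc]; exact F.specialized_comp hs d.spec), B.push_tr, O.tr_θ]

namespace AddPresentation

variable {A : BivData.{w} F}

theorem hom_ext (P : AddPresentation.{w, w'} A) {X Y : C} {φ : X ⟶ Y} {H : Type w'}
    [AddCommGroup H] {ψ₁ ψ₂ : A.grp φ →+ H} (h : ∀ c, ψ₁ (P.cls c) = ψ₂ (P.cls c)) : ψ₁ = ψ₂ :=
  (P.free φ H (fun c => ψ₂ (P.cls c)) (fun c c' hc => by rw [P.cls_iso c c' hc])
    (fun c c₁ c₂ hc => by rw [P.cls_decomp c c₁ c₂ hc, map_add])).unique h fun _ => rfl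

theorem push_thetaEl (P : AddPresentation.{w, w'} A) {X Y : C} {φ : X ⟶ Y} (c : PreCyc F φ) :
    A.push c.m φ c.conf (P.thetaEl (c.m ≫ φ) c.spec) = P.cls c := by
  unfold thetaEl
  rw [P.cls_push]
  exact P.cls_iso _ _ ⟨Iso.refl _, rfl⟩

end AddPresentation

/-- Assume the functoriality has good coproducts, satisfies
`𝒞`-independence, has a symmetric class of independent squares, and specialized
morphisms are stable under independent pullbacks.  Let `𝔹` be a stably oriented
additive bivariant theory.  Then there exists a unique orientation preserving
Grothendieck transformation `η : 𝔸 → 𝔹` from the universal additive bivariant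
theory `𝔸`. -/
theorem universal_additive_theory_universal_property {C : Type u} [Category.{v} C]
    (F : BivFun C) (D : GoodCoproducts F) (hsymm : IndepSymm F)
    (hCIr : CIndepRight F) (hCIb : CIndepBot F) (hss : SpecStable F)
    (A : BivData.{w} F) (hA : IsBivTheory A) (P : AddPresentation.{w, w'} A)
    (B : BivData.{w'} F) (hB : IsBivTheory B) (O : StableOrientation B)
    (hAdd : IsAdditive B O.toBivOrientation D) :
    ∃ η : GrothTrans A B,
      (∀ (X Y : C) (f : X ⟶ Y) (hs : F.specialized f),
        η.map f (P.thetaEl f hs) = O.θ f hs) ∧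
      (∀ η' : GrothTrans A B,
        (∀ (X Y : C) (f : X ⟶ Y) (hs : F.specialized f),
          η'.map f (P.thetaEl f hs) = O.θ f hs) → η' = η) := by
  let O' := O.toBivOrientation
  choose map map_cls _ using fun (X Y : C) (φ : X ⟶ Y) =>
    P.free φ (B.grp φ) O'.cycleClass (hAdd.cycleClass_iso hB) (hAdd.cycleClass_decomp hB)
  have := F.hasPullbacks
  let η : GrothTrans A B :=
    { map := fun X Y f => map X Y f
      map_push := fun X X' Y g h hg => by
        refine DFunLike.congr_fun (P.hom_ext (ψ₁ := (map _ _ h).comp (A.pushHom hA g h hg))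
          (ψ₂ := (B.pushHom hB g h hg).comp (map _ _ (g ≫ h))) fun c => ?_)
        change map _ _ h (A.push g h hg (P.cls c)) = B.push g h hg (map _ _ (g ≫ h) (P.cls c))
        rw [P.cls_push, map_cls, map_cls]
        exact (O'.cycleClass_comp hB c.m g h c.conf hg c.spec _).symm
      map_pull := fun X Y X' Y' bot top l r hsq => by
        refine DFunLike.congr_fun (P.hom_ext (ψ₁ := (map _ _ top).comp (A.pullHom hA hsq))
          (ψ₂ := (B.pullHom hB hsq).comp (map _ _ bot)) fun c => ?_)
        change map _ _ top (A.pull hsq (P.cls c)) = B.pull hsq (map _ _ bot (P.cls c))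
        have hpb := IsPullback.of_hasPullback l c.m
        have hs := hss (F.indep_hcomp (hCIb hpb c.conf) hsq) c.spec
        rw [P.cls_pull hsq c _ _ _ hpb hs, map_cls, map_cls,
          O.pull_cycleClass hB hCIb hsq c hpb hs]
      map_mul := fun X Y Z f g α β => by
        refine DFunLike.congr_fun (DFunLike.congr_fun (?_ :
          ((A.mulHom hA f g).compr₂ (map _ _ (f ≫ g)) : A.grp f →+ A.grp g →+ B.grp (f ≫ g)) =
            ((B.mulHom hB f g).comp (map _ _ f)).compl₂ (map _ _ g)) α) β
        have key (c : PreCyc F f) (d : PreCyc F g) :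
            map _ _ (f ≫ g) (A.mul (P.cls c) (P.cls d)) =
              B.mul (map _ _ f (P.cls c)) (map _ _ g (P.cls d)) := by
          have hX' := IsPullback.of_hasPullback f d.m
          have hV' := IsPullback.of_hasPullback c.m (pullback.fst f d.m)
          have hsq := hCIr hX'.flip d.conf
          have hww := F.confined_pullback hV'.flip c.conf
          have hconf := F.confined_comp hww (F.confined_pullback hX' d.conf)
          have hs := F.specialized_comp
            (hss (F.indep_hcomp (hCIb hV'.flip c.conf) hsq) c.spec) d.spec
          have hspec : F.specialized ((pullback.snd c.m (pullback.fst f d.m) ≫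
              pullback.fst f d.m) ≫ f ≫ g) := by
            convert hs using 1
            simp [pullback.condition_assoc]
          rw [P.cls_mul c d _ _ _ hX' _ _ _ hV' hconf hspec, map_cls, map_cls, map_cls,
            O.mul_cycleClass hB hCIr hCIb c d hX' hV' hconf hspec]
        ext α β
        revert β
        refine DFunLike.congr_fun (P.hom_ext fun d => ?_)
        revert α
        exact DFunLike.congr_fun (P.hom_ext
          (ψ₁ := (map _ _ (f ≫ g)).comp ((A.mulHom hA f g).flip (P.cls d)))
          (ψ₂ := ((B.mulHom hB f g).flip (map _ _ g (P.cls d))).comp (map _ _ f))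
          fun c => key c d) }
  refine ⟨η, fun X Y f hs => ?_, fun η' hη' => GrothTrans.ext_map fun X Y f =>
    P.hom_ext fun c => ?_⟩
  · refine (map_cls _ _ _ _).trans ?_
    exact (hB.push_id f _ _).trans (O'.tr_θ _ _ _)
  · refine Eq.trans ?_ (map_cls _ _ _ c).symm
    rw [← P.push_thetaEl, η'.map_push, hη']
    rfl
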